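/- Let x ≥ 1, k ≥ 2, i ∈ {−1, 0, 1}, n + i ≥ k + 2, and suppose max{n + i, 16x} < 2^{ck} for some real c ∈ (0, 0.25). Then there exists a real number ξ_{n+i} with (L_{n+i}^{(k)})^x = 3^x · 2^{(n+i−2)x} (1 + ξ_{n+i}) and |ξ_{n+i}| < 2 / 2^{(1−2c)k}. -/

import Mathlib

/-- Auxiliary: `lucasAux k j` is the `k`-generalized Lucas number `L^{(k)}_{j + 2 - k}`. -/
def lucasAux (k : ℕ) : ℕ → ℤ
  | j =>
    if _h1 : j < k - 2 then 0
    else if _h2 : j = k - 2 then 2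
    else if _h3 : j = k - 1 then 1
    else ∑ i ∈ Finset.range k, lucasAux k (j - (i + 1))
termination_by j => j
decreasing_by omega

/-- The `k`-generalized Lucas sequence, indexed by the integers:
`L_{2-k} = ⋯ = L_{-1} = 0`, `L_0 = 2`, `L_1 = 1`, and
`L_n = L_{n-1} + ⋯ + L_{n-k}` for `n ≥ 2`; moreover `L_{-1} = -1` when `k = 2`
(the backwards extension of the recurrence). -/
def genLucas (k : ℕ) (n : ℤ) : ℤ :=
  if k = 2 ∧ n = -1 then -1
  else if 2 - (k : ℤ) ≤ n then lucasAux k (n - (2 - (k : ℤ))).toNat else 0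

theorem lucasAux_of_lt {k j : ℕ} (h : j < k - 2) : lucasAux k j = 0 := by
  rw [lucasAux, dif_pos h]

theorem lucasAux_sub_two (k : ℕ) : lucasAux k (k - 2) = 2 := by
  rw [lucasAux, dif_neg (lt_irrefl _), dif_pos rfl]

theorem lucasAux_sub_one {k : ℕ} (hk : 2 ≤ k) : lucasAux k (k - 1) = 1 := by
  rw [lucasAux, dif_neg (by omega), dif_neg (by omega), dif_pos rfl]

theorem lucasAux_add {k : ℕ} (hk : 2 ≤ k) (t : ℕ) :
    lucasAux k (k + t) = ∑ i ∈ Finset.range k, lucasAux k (k + t - (i + 1)) := by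
  rw [lucasAux, dif_neg (by omega), dif_neg (by omega), dif_neg (by omega)]

theorem lucasAux_self {k : ℕ} (hk : 2 ≤ k) : lucasAux k k = 3 := by
  have h := lucasAux_add hk 0
  have h2 := lucasAux_sub_two k
  have h1 := lucasAux_sub_one hk
  obtain ⟨m, rfl⟩ := Nat.exists_eq_add_of_le' hk
  rw [Finset.sum_range_succ', Finset.sum_range_succ',
    Finset.sum_eq_zero fun i _ => lucasAux_of_lt (by have := Finset.mem_range.1 ‹_›; omega)] at h
  simp only [Nat.add_zero, Nat.zero_add, Nat.add_sub_cancel, Nat.reduceAdd] at h h1 h2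
  rw [h, h1, h2]
  norm_num

theorem lucasAux_add_succ {k : ℕ} (hk : 2 ≤ k) (t : ℕ) :
    lucasAux k (k + (t + 1)) = 2 * lucasAux k (k + t) - lucasAux k t := by
  have h := lucasAux_add hk t
  have h' := lucasAux_add hk (t + 1)
  obtain ⟨m, rfl⟩ := Nat.exists_eq_add_of_le' (show 1 ≤ k by omega)
  rw [Finset.sum_range_succ, show m + 1 + t - (m + 1) = t by omega] at h
  rw [Finset.sum_range_succ', show m + 1 + (t + 1) - (0 + 1) = m + 1 + t by omega,
    Finset.sum_congr rfl fun i _ => congrArg (lucasAux (m + 1))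
      (show m + 1 + (t + 1) - (i + 1 + 1) = m + 1 + t - (i + 1) by omega)] at h'
  linarith

theorem lucasAux_nonneg {k : ℕ} (hk : 2 ≤ k) (j : ℕ) : 0 ≤ lucasAux k j := by
  induction j using Nat.strong_induction_on with
  | _ j ih =>
    rcases lt_or_ge j k with h | h
    · rw [lucasAux]
      split_ifs <;> omega
    · obtain ⟨t, rfl⟩ := Nat.exists_eq_add_of_le h
      rw [lucasAux_add hk]
      exact Finset.sum_nonneg fun i _ => ih _ (by omega)

theorem lucasAux_add_le {k : ℕ} (hk : 2 ≤ k) (t : ℕ) : lucasAux k (k + t) ≤ 3 * 2 ^ t := by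
  induction t with
  | zero => simp [lucasAux_self hk]
  | succ t ih =>
    rw [lucasAux_add_succ hk, pow_succ]
    linarith [lucasAux_nonneg hk t]

theorem two_pow_mul_lucasAux_le {k : ℕ} (hk : 2 ≤ k) (j : ℕ) :
    2 ^ k * lucasAux k j ≤ 2 ^ (j + 3) := by
  rcases lt_or_ge j k with h | h
  · obtain h | rfl | rfl : j < k - 2 ∨ j = k - 2 ∨ j = k - 1 := by omega
    · rw [lucasAux_of_lt h, mul_zero]
      positivity
    · rw [lucasAux_sub_two, ← pow_succ]
      exact pow_le_pow_right₀ (by norm_num) (by omega)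
    · rw [lucasAux_sub_one hk, mul_one]
      exact pow_le_pow_right₀ (by norm_num) (by omega)
  · obtain ⟨t, rfl⟩ := Nat.exists_eq_add_of_le h
    rw [add_assoc, pow_add]
    gcongr
    rw [pow_add]
    linarith [lucasAux_add_le hk t, pow_pos (two_pos : (0 : ℤ) < 2) t]

theorem two_pow_mul_sub_lucasAux_le {k : ℕ} (hk : 2 ≤ k) (t : ℕ) :
    2 ^ k * (3 * 2 ^ t - lucasAux k (k + t)) ≤ t * 2 ^ (t + 2) := by
  induction t with
  | zero => simp [lucasAux_self hk]
  | succ t ih =>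
    rw [lucasAux_add_succ hk]
    have h := two_pow_mul_lucasAux_le hk t
    push_cast
    simp only [pow_succ _ (t + _), pow_succ _ t] at h ih ⊢
    linarith

theorem genLucas_eq_lucasAux {k : ℕ} (hk : 2 ≤ k) (t : ℕ) :
    genLucas k (t + 2) = lucasAux k (k + t) := by
  rw [genLucas, if_neg (by omega), if_pos (by omega)]
  congr 1
  omega

theorem gen_lucas_pow_two_approx (k x : ℕ) (n i : ℤ) (hx : 1 ≤ x) (hk : 2 ≤ k)
    (hi : i = -1 ∨ i = 0 ∨ i = 1) (hni : (k : ℤ) + 2 ≤ n + i)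
    (c : ℝ) (hc0 : 0 < c) (hc1 : c < 0.25)
    (hmax : ((max (n + i) (16 * (x : ℤ)) : ℤ) : ℝ) < (2 : ℝ) ^ (c * (k : ℝ))) :
    ∃ ξ : ℝ, ((genLucas k (n + i) : ℝ)) ^ x
        = 3 ^ x * (2 : ℝ) ^ ((n + i - 2) * (x : ℤ)) * (1 + ξ) ∧
      |ξ| < 2 / (2 : ℝ) ^ ((1 - 2 * c) * (k : ℝ)) := by
  obtain ⟨t, ht⟩ : ∃ t : ℕ, n + i = t + 2 := ⟨(n + i - 2).toNat, by omega⟩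
  rw [ht] at hmax ⊢
  rw [genLucas_eq_lucasAux hk, add_sub_cancel_right, zpow_mul, zpow_natCast, zpow_natCast,
    ← mul_pow]
  rw [Int.cast_max, max_lt_iff] at hmax
  obtain ⟨hty, hxy⟩ := hmax
  push_cast at hty hxy
  have hL0 : (0 : ℝ) ≤ lucasAux k (k + t) := by exact_mod_cast lucasAux_nonneg hk _
  have hLA : (lucasAux k (k + t) : ℝ) ≤ 3 * 2 ^ t := by exact_mod_cast lucasAux_add_le hk t
  have hd : (2 : ℝ) ^ k * (3 * 2 ^ t - lucasAux k (k + t)) ≤ t * 2 ^ (t + 2) := by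
    exact_mod_cast two_pow_mul_sub_lucasAux_le hk t
  have hexp : (2 : ℝ) ^ ((1 - 2 * c) * (k : ℝ)) * ((2 : ℝ) ^ (c * (k : ℝ))) ^ 2 = 2 ^ k := by
    rw [pow_two, ← Real.rpow_add two_pos, ← Real.rpow_add two_pos, ← Real.rpow_natCast]
    congr 1
    ring
  have hz : (0 : ℝ) < 2 ^ ((1 - 2 * c) * (k : ℝ)) := by positivity
  generalize (2 : ℝ) ^ ((1 - 2 * c) * (k : ℝ)) = z at *
  generalize (2 : ℝ) ^ (c * (k : ℝ)) = y at *
  generalize (lucasAux k (k + t) : ℝ) = L at *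
  have hA : (0 : ℝ) < 3 * 2 ^ t := by positivity
  obtain ⟨r, rfl⟩ : ∃ r, L = 3 * 2 ^ t * r := ⟨L / (3 * 2 ^ t), by field_simp⟩
  have hr0 : 0 ≤ r := nonneg_of_mul_nonneg_right hL0 hA
  have hr1 : r ≤ 1 := by
    rw [← mul_le_mul_iff_right₀ hA]
    linarith
  have hd' : 2 ^ k * (3 * (1 - r)) ≤ (4 * t : ℝ) := by
    rw [← mul_le_mul_iff_right₀ (pow_pos (two_pos : (0 : ℝ) < 2) t)]
    rw [pow_add] at hd
    linarith
  refine ⟨r ^ x - 1, by rw [mul_pow]; ring, ?_⟩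
  have hbern : 1 + (x : ℝ) * (r - 1) ≤ r ^ x := by
    simpa using one_add_mul_le_pow (show (-2 : ℝ) ≤ r - 1 by linarith) x
  have hpow : r ^ x ≤ 1 := pow_le_one₀ hr0 hr1
  have hx0 : (1 : ℝ) ≤ x := by exact_mod_cast hx
  have ht0 : (0 : ℝ) ≤ t := t.cast_nonneg
  have hy : 0 < y := by linarith
  have hxt : (16 * x : ℝ) * t ≤ y * y := mul_le_mul hxy.le (by linarith) ht0 hy.le
  have hmain : z * y ^ 2 * (x * (1 - r)) < 2 * y ^ 2 := by
    rw [hexp]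
    have := mul_le_mul_of_nonneg_left hd' (show (0 : ℝ) ≤ x by linarith)
    nlinarith [mul_pos hy hy]
  rw [abs_of_nonpos (by linarith), lt_div_iff₀ hz]
  have hzx : z * (x * (1 - r)) < 2 := by
    rw [← mul_lt_mul_iff_left₀ (pow_pos hy 2)]
    linarith
  nlinarith
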